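/- Every level-injective ω-poset is weakly graded; that is, if every level of an ω-poset P is a minimal cap, then consecutive levels P_n and P_{n+1} share only atoms of P (equivalently, every non-atomic p ∈ P has a lower bound q with r(q) = r(p) + 1). -/

import Mathlib

/-- `A` refines `B`: every element of `A` lies below some element of `B`. -/
def Refines {α : Type*} [PartialOrder α] (A B : Set α) : Prop :=
  ∀ a ∈ A, ∃ b ∈ B, a ≤ b

/-- A band: a finite subset such that every element of the poset is comparable with some member. -/
def IsBand {α : Type*} [PartialOrder α] (B : Set α) : Prop :=
  B.Finite ∧ ∀ p : α, ∃ b ∈ B, p ≤ b ∨ b ≤ p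

/-- A cap: a subset refined by some band. -/
def IsCap {α : Type*} [PartialOrder α] (C : Set α) : Prop :=
  ∃ B : Set α, IsBand B ∧ Refines B C

/-- A minimal cap: a cap no proper subset of which is a cap. -/
def IsMinimalCap {α : Type*} [PartialOrder α] (C : Set α) : Prop :=
  IsCap C ∧ ∀ D : Set α, D ⊂ C → ¬ IsCap D

/-- A selector: a subset meeting every cap. -/
def IsSelector {α : Type*} [PartialOrder α] (S : Set α) : Prop :=
  ∀ C : Set α, IsCap C → (S ∩ C).Nonempty

/-- A minimal selector: a selector minimal under inclusion among selectors. -/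
def IsMinSelector {α : Type*} [PartialOrder α] (S : Set α) : Prop :=
  IsSelector S ∧ ∀ T : Set α, T ⊆ S → IsSelector T → T = S

/-- An ω-poset: every principal filter is finite, and for each `n` only finitely many
principal filters have exactly `n` elements. -/
def IsOmegaPoset (α : Type*) [PartialOrder α] : Prop :=
  (∀ p : α, (Set.Ici p).Finite) ∧ ∀ n : ℕ, {p : α | (Set.Ici p).ncard = n}.Finite

/-- The rank of `p`: the length of the longest strictly increasing chain starting at `p`,
i.e. `r(p) = sup_{q > p} (r(q) + 1)`. -/
noncomputable def chainRank {α : Type*} [PartialOrder α] (p : α) : ℕ :=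
  sSup {n : ℕ | ∃ c : ℕ → α, c 0 = p ∧ ∀ i < n, c i < c (i + 1)}

/-- The `n`-th level: the minimal elements of the `n`-th cone `{p | chainRank p ≤ n}`. -/
def levelSet (α : Type*) [PartialOrder α] (n : ℕ) : Set α :=
  {p : α | chainRank p ≤ n ∧ ∀ q : α, q < p → ¬ chainRank q ≤ n}

/-- Predetermined: every non-minimal `p` has some `q < p` all of whose strict upper bounds
lie above `p`. -/
def Predetermined (α : Type*) [PartialOrder α] : Prop :=
  ∀ p : α, ¬ IsMin p → ∃ q : α, q < p ∧ ∀ r : α, q < r → p ≤ r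

/-- Branching. -/
def Branching (α : Type*) [PartialOrder α] : Prop :=
  ∀ p q : α, p < q → ∃ r : α, r < q ∧ ¬ r ≤ p ∧ ¬ p ≤ r

/-- The cap-order on elements: `p ≾ q` iff adding `q` to any family keeping `p` a cap keeps a cap. -/
def CapBelow {α : Type*} [PartialOrder α] (p q : α) : Prop :=
  ∀ F : Set α, IsCap (F ∪ {p}) → IsCap (F ∪ {q})

/-- Cap-determined: the cap-order on elements agrees with the order. -/
def CapDetermined (α : Type*) [PartialOrder α] : Prop :=
  ∀ p q : α, CapBelow p q → p ≤ q

/-- Graded: immediate predecessors have rank exactly one more. -/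
def GradedPoset (α : Type*) [PartialOrder α] : Prop :=
  ∀ p q : α, p ⋖ q → chainRank p = chainRank q + 1

/-- `Wedge p q`: `p` and `q` have a common lower bound. -/
def Wedge {α : Type*} [PartialOrder α] (p q : α) : Prop :=
  ∃ r : α, r ≤ p ∧ r ≤ q

/-- Star-below: `p ◁ q` iff there is a cap `C` with every element of the star `Cp` below `q`. -/
def StarBelow {α : Type*} [PartialOrder α] (p q : α) : Prop :=
  ∃ C : Set α, IsCap C ∧ ∀ c ∈ C, Wedge c p → c ≤ q

/-- Regular: every cap is ◁-refined by some cap. -/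
def RegularPoset (α : Type*) [PartialOrder α] : Prop :=
  ∀ C : Set α, IsCap C → ∃ D : Set α, IsCap D ∧ ∀ d ∈ D, ∃ c ∈ C, StarBelow d c

/-- Prime: for every `p` there is `F` with `F ∪ {p}` a cap but `F` not a cap. -/
def PrimePoset (α : Type*) [PartialOrder α] : Prop :=
  ∀ p : α, ∃ F : Set α, IsCap (F ∪ {p}) ∧ ¬ IsCap F

/-- Cluster: connected with respect to the common-lower-bound relation. -/
def IsCluster {α : Type*} [PartialOrder α] (C : Set α) : Prop :=
  ∀ A B : Set α, A.Nonempty → B.Nonempty → A ∪ B = C → ∃ a ∈ A, ∃ b ∈ B, Wedge a b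

/-- `D^{≤_B ≥}`: the elements sharing an upper bound in `B` with some element of `D`. -/
def SharedUpper {α : Type*} [PartialOrder α] (D B : Set α) : Set α :=
  {p : α | ∃ d ∈ D, ∃ b ∈ B, p ≤ b ∧ d ≤ b}

/-- Weakly tangled refinement. -/
def WeaklyTangledRefinement {α : Type*} [PartialOrder α] (A B : Set α) : Prop :=
  Refines A B ∧ ∀ C D : Set α, C ⊆ A → D ⊆ A → IsCluster C → IsCluster D →
    (C ∩ D).Nonempty → C ⊆ SharedUpper D B ∨ D ⊆ SharedUpper C B

/-- Weakly tangled poset: every cap has a weakly tangled refinement which is a cap. -/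
def WeaklyTangled (α : Type*) [PartialOrder α] : Prop :=
  ∀ C : Set α, IsCap C → ∃ A : Set α, IsCap A ∧ WeaklyTangledRefinement A C

/-- Injectivity of `≤` from level `n` to level `m`: every `p` in level `m` has a witness
`q` in level `n` below `p` and below no other element of level `m`. -/
def LevelInjOn (α : Type*) [PartialOrder α] (m n : ℕ) : Prop :=
  ∀ p ∈ levelSet α m, ∃ q ∈ levelSet α n,
    q ≤ p ∧ ∀ p' ∈ levelSet α m, q ≤ p' → p' = p

/-- The spectrum: the set of minimal selectors. -/
def Spectrum (α : Type*) [PartialOrder α] : Type _ :=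
  {S : Set α // IsMinSelector S}

/-- The topology on the spectrum generated by the sets `p^∈ = {S | p ∈ S}`. -/
instance {α : Type*} [PartialOrder α] : TopologicalSpace (Spectrum α) :=
  TopologicalSpace.generateFrom
    {U : Set (Spectrum α) | ∃ p : α, U = {S : Spectrum α | p ∈ S.1}}

/-- A basis of nonempty (open) sets. -/
def IsNeBasis {X : Type*} [TopologicalSpace X] (P : Set (Set X)) : Prop :=
  TopologicalSpace.IsTopologicalBasis P ∧ ∀ p ∈ P, p.Nonempty

/-- Cap-basis: a basis of nonempty open sets whose caps (under inclusion) are exactly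
the covers of the space. -/
def IsCapBasis {X : Type*} [TopologicalSpace X] (P : Set (Set X)) : Prop :=
  IsNeBasis P ∧ ∀ C : Set ↥P, (IsCap C ↔ (⋃ c ∈ C, (c : Set X)) = Set.univ)

/-- Band-basis: a basis of nonempty open sets whose bands (under inclusion) are exactly
the finite covers of the space. -/
def IsBandBasis {X : Type*} [TopologicalSpace X] (P : Set (Set X)) : Prop :=
  IsNeBasis P ∧ ∀ B : Set ↥P, (IsBand B ↔ B.Finite ∧ (⋃ b ∈ B, (b : Set X)) = Set.univ)

theorem Refines.trans {α : Type*} [PartialOrder α] {A B C : Set α} (hAB : Refines A B)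
    (hBC : Refines B C) : Refines A C := by
  intro a ha
  obtain ⟨b, hb, hab⟩ := hAB a ha
  obtain ⟨c, hc, hbc⟩ := hBC b hb
  exact ⟨c, hc, hab.trans hbc⟩

theorem IsCap.of_refines {α : Type*} [PartialOrder α] {C D : Set α} (hC : IsCap C)
    (hCD : Refines C D) : IsCap D := by
  obtain ⟨B, hB, hBC⟩ := hC
  exact ⟨B, hB, hBC.trans hCD⟩

theorem chain_length_le_ncard_Ici {α : Type*} [PartialOrder α] {p : α}
    (hp : (Set.Ici p).Finite) {n : ℕ} {c : ℕ → α} (h0 : c 0 = p)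
    (hc : ∀ i < n, c i < c (i + 1)) : n ≤ (Set.Ici p).ncard := by
  have hmono : StrictMonoOn c (Set.Iic n) :=
    strictMonoOn_Iic_of_lt_succ fun i hi => by simpa using hc i hi
  have hsub : c '' Set.Iic n ⊆ Set.Ici p := by
    rintro _ ⟨i, hi, rfl⟩
    rw [Set.mem_Ici, ← h0]
    exact hmono.monotoneOn (Set.mem_Iic.2 n.zero_le) hi i.zero_le
  have hcard := Set.ncard_le_ncard hsub hp
  rw [hmono.injOn.ncard_image, Set.ncard_eq_toFinset_card'] at hcard
  simp only [Set.toFinset_Iic, Nat.card_Iic] at hcard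
  omega

theorem le_chainRank_iff {α : Type*} [PartialOrder α] {p : α} (hp : (Set.Ici p).Finite) {n : ℕ} :
    n ≤ chainRank p ↔ ∃ c : ℕ → α, c 0 = p ∧ ∀ i < n, c i < c (i + 1) := by
  set S := {n : ℕ | ∃ c : ℕ → α, c 0 = p ∧ ∀ i < n, c i < c (i + 1)}
  have hbdd : BddAbove S := ⟨_, fun _ ⟨_, h0, hc⟩ => chain_length_le_ncard_Ici hp h0 hc⟩
  have hne : S.Nonempty := ⟨0, fun _ => p, rfl, by simp⟩
  refine ⟨fun hn => ?_, fun hn => le_csSup hbdd hn⟩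
  obtain ⟨c, h0, hc⟩ := Nat.sSup_mem hne hbdd
  exact ⟨c, h0, fun i hi => hc i (hi.trans_le hn)⟩

theorem chainRank_lt_of_lt {α : Type*} [PartialOrder α] (hfin : ∀ p : α, (Set.Ici p).Finite)
    {p q : α} (hqp : q < p) : chainRank p < chainRank q := by
  obtain ⟨c, h0, hc⟩ := (le_chainRank_iff (hfin p)).1 le_rfl
  refine (le_chainRank_iff (hfin q)).2 ⟨fun i => Nat.casesOn i q c, rfl, fun i hi => ?_⟩
  cases i with
  | zero => simpa [h0] using hqp
  | succ i => exact hc i (by omega)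

theorem exists_gt_chainRank_eq {α : Type*} [PartialOrder α]
    (hfin : ∀ p : α, (Set.Ici p).Finite) {q : α} {m : ℕ} (hq : chainRank q = m + 1) :
    ∃ p : α, q < p ∧ chainRank p = m := by
  obtain ⟨c, h0, hc⟩ := (le_chainRank_iff (hfin q)).1 hq.ge
  have hlt : q < c 1 := h0 ▸ hc 0 m.succ_pos
  have hle : m ≤ chainRank (c 1) :=
    (le_chainRank_iff (hfin _)).2 ⟨fun i => c (i + 1), rfl, fun i hi => hc (i + 1) (by omega)⟩
  have := chainRank_lt_of_lt hfin hlt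
  exact ⟨c 1, hlt, by omega⟩

theorem mem_levelSet_chainRank {α : Type*} [PartialOrder α]
    (hfin : ∀ p : α, (Set.Ici p).Finite) (p : α) : p ∈ levelSet α (chainRank p) :=
  ⟨le_rfl, fun _ hq => (chainRank_lt_of_lt hfin hq).not_ge⟩

/-- If `p` has rank less than `m` and is not in level `m + 1`, then level `m + 1` refines
level `m` with `p` removed. -/
theorem refines_levelSet_diff_singleton {α : Type*} [PartialOrder α]
    (hfin : ∀ p : α, (Set.Ici p).Finite) {p : α} {m : ℕ} (hp : chainRank p < m)
    (hpm : p ∉ levelSet α (m + 1)) :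
    Refines (levelSet α (m + 1)) (levelSet α m \ {p}) := by
  intro t ht
  rcases ht.1.eq_or_lt with hrank | hrank
  · obtain ⟨s, hts, hs⟩ := exists_gt_chainRank_eq hfin hrank
    refine ⟨s, ⟨hs ▸ mem_levelSet_chainRank hfin s, ?_⟩, hts.le⟩
    rintro rfl
    omega
  · exact ⟨t, ⟨⟨by omega, fun q hq hle => ht.2 q hq (by omega)⟩, fun h => hpm (h ▸ ht)⟩, le_rfl⟩

/-- Every level-injective ω-poset is weakly graded: consecutive levels
share only atoms (minimal elements). -/
theorem levelInjective_weaklyGraded {α : Type*} [PartialOrder α] (h : IsOmegaPoset α)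
    (hli : ∀ n : ℕ, IsMinimalCap (levelSet α n)) :
    ∀ n : ℕ, ∀ p ∈ levelSet α n ∩ levelSet α (n + 1), IsMin p := by
  rintro n p ⟨⟨hpn, -⟩, -, hpbelow⟩
  by_contra hmin
  obtain ⟨q₀, hq₀⟩ := not_isMin_iff.1 hmin
  obtain ⟨q, hq, hqmin⟩ : ∃ q < p, ∀ s < p, chainRank q ≤ chainRank s := by
    obtain ⟨q, hq, hle⟩ := (measure (chainRank (α := α))).wf.has_min (Set.Iio p) ⟨q₀, hq₀⟩
    exact ⟨q, hq, fun s hs => not_lt.1 (hle s hs)⟩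
  have hqn := hpbelow q hq
  obtain ⟨m, hm⟩ : ∃ m, chainRank q = m + 1 := ⟨chainRank q - 1, by omega⟩
  have hpm : p ∈ levelSet α m := ⟨by omega, fun s hs => by have := hqmin s hs; omega⟩
  exact (hli m).2 _ (Set.sdiff_singleton_ssubset.2 hpm) <| (hli (m + 1)).1.of_refines <|
    refines_levelSet_diff_singleton h.1 (by omega) fun hp' => hp'.2 q hq hm.le
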